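/- Let u = (u_1,…,u_N) : ℝ^d × [0,T) → ℝ^N be a classical solution of the Allen–Cahn system (AC) with Σ_{i=1}^N u_i(x,t)² = 1 for all (x,t), and suppose μ₀ᵋ(Q) ≤ D. Let G(s) = σ⁻¹ ∫₀^s √(2W(y)) dy. Then for each i and all 0 ≤ t₁ < t₂ < T, ∫_Q |G(u_i(x,t₂)) − G(u_i(x,t₁))| dx ≤ (3/2) D √(t₂ − t₁). -/

import Mathlib

open MeasureTheory Set Filter
open scoped InnerProductSpace

noncomputable section

/-- Euclidean space `ℝ^d`. -/
abbrev Euc (d : ℕ) := EuclideanSpace ℝ (Fin d)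

/-- The double-well potential `W(s) = s²(1-s)²/2`. -/
def W (s : ℝ) : ℝ := s ^ 2 * (1 - s) ^ 2 / 2

/-- Its derivative `W'(s) = 2s³ - 3s² + s`. -/
def W' (s : ℝ) : ℝ := 2 * s ^ 3 - 3 * s ^ 2 + s

/-- Partial derivative in the `k`-th coordinate direction. -/
def pd (d : ℕ) (k : Fin d) (f : Euc d → ℝ) (x : Euc d) : ℝ :=
  fderiv ℝ f x (EuclideanSpace.single k 1)

/-- The Laplacian of `f : ℝ^d → ℝ`. -/
def lap (d : ℕ) (f : Euc d → ℝ) (x : Euc d) : ℝ :=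
  ∑ k : Fin d, pd d k (fun y => pd d k f y) x

/-- The vector in `ℝ^d` with integer coordinates `v`. -/
def intVec {d : ℕ} (v : Fin d → ℤ) : Euc d :=
  (EuclideanSpace.equiv (Fin d) ℝ).symm (fun k => (v k : ℝ))

/-- A function on `ℝ^d` is `ℤ^d`-periodic if it is invariant under translation by
every integer vector. -/
def ZPeriodic {d : ℕ} {α : Type*} (f : Euc d → α) : Prop :=
  ∀ (x : Euc d) (v : Fin d → ℤ), f (x + intVec v) = f x

/-- The fundamental domain `Q = [0,1)^d` of the torus. -/
def QCube (d : ℕ) : Set (Euc d) := {x | ∀ k, x k ∈ Ico (0:ℝ) 1}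

/-- `σ = ∫₀¹ √(2W(a)) da`. -/
def sigma0 : ℝ := ∫ a in (0:ℝ)..1, Real.sqrt (2 * W a)

/-- A classical solution of the Allen–Cahn system (AC): `ℤ^d`-periodic in `x`, twice
continuously differentiable in `x` and once in `t` (with continuous derivatives), and
satisfying `ε ∂ₜ uᵢ = ε Δuᵢ - W'(uᵢ)/ε + λᵋ uᵢ` on `ℝ^d × (0,T)`, where
`λᵋ = Σⱼ uⱼ (-ε Δuⱼ + W'(uⱼ)/ε)`. -/
structure IsACSolution (d N : ℕ) (T ε : ℝ) (u : Fin N → ℝ → Euc d → ℝ) : Prop where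
  periodic : ∀ i t, ZPeriodic (u i t)
  regx : ∀ i t, ContDiff ℝ 2 (u i t)
  regt : ∀ i x, ContDiffOn ℝ 1 (fun s => u i s x) (Ico 0 T)
  cont_u : ∀ i, ContinuousOn (fun p : ℝ × Euc d => u i p.1 p.2) (Ico 0 T ×ˢ univ)
  cont_dt : ∀ i, ContinuousOn (fun p : ℝ × Euc d => deriv (fun s => u i s p.2) p.1)
    (Ioo 0 T ×ˢ univ)
  cont_grad : ∀ i, ContinuousOn (fun p : ℝ × Euc d => gradient (u i p.1) p.2)
    (Ico 0 T ×ˢ univ)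
  cont_lap : ∀ i, ContinuousOn (fun p : ℝ × Euc d => lap d (u i p.1) p.2)
    (Ico 0 T ×ˢ univ)
  eqn : ∀ i x, ∀ t ∈ Ioo 0 T,
    ε * deriv (fun s => u i s x) t =
      ε * lap d (u i t) x - W' (u i t x) / ε +
        (∑ j, u j t x * (-(ε * lap d (u j t) x) + W' (u j t x) / ε)) * u i t x

/-- `μₜ^{i,ε}(Q) = σ⁻¹ ∫_Q (ε|∇uᵢ|²/2 + W(uᵢ)/ε) dx`. -/
def muI (d : ℕ) (ε : ℝ) (f : ℝ → Euc d → ℝ) (t : ℝ) : ℝ :=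
  sigma0⁻¹ * ∫ x in QCube d, (ε * ‖gradient (f t) x‖ ^ 2 / 2 + W (f t x) / ε)

/-- `μₜᵋ(Q) = Σᵢ μₜ^{i,ε}(Q)`. -/
def muE (d N : ℕ) (ε : ℝ) (u : Fin N → ℝ → Euc d → ℝ) (t : ℝ) : ℝ :=
  ∑ i, muI d ε (u i) t

/-- `G(s) = σ⁻¹ ∫₀^s √(2W(y)) dy`. -/
def Gfun (s : ℝ) : ℝ := sigma0⁻¹ * ∫ y in (0:ℝ)..s, Real.sqrt (2 * W y)

lemma exists_isCompact_qCube_subset (d : ℕ) : ∃ K : Set (Euc d), IsCompact K ∧ QCube d ⊆ K := by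
  refine ⟨WithLp.toLp 2 '' Icc (0 : Fin d → ℝ) 1,
    isCompact_Icc.image (PiLp.continuous_toLp 2 _), fun x hx => ⟨WithLp.ofLp x, ?_, rfl⟩⟩
  exact ⟨fun k => (hx k).1, fun k => (hx k).2.le⟩

lemma measurableSet_qCube (d : ℕ) : MeasurableSet (QCube d) := by
  have h : QCube d = ⋂ k, (fun x : Euc d => x k) ⁻¹' Ico (0 : ℝ) 1 := by
    ext x
    simp [QCube]
  rw [h]
  exact MeasurableSet.iInter fun k =>
    (by fun_prop : Continuous fun x : Euc d => x k).measurable measurableSet_Ico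

instance isFiniteMeasure_restrict_qCube (d : ℕ) :
    IsFiniteMeasure ((volume : Measure (Euc d)).restrict (QCube d)) := by
  obtain ⟨K, hK, hQ⟩ := exists_isCompact_qCube_subset d
  exact ⟨by simpa using (measure_mono hQ).trans_lt hK.measure_lt_top⟩

lemma integrableOn_qCube {d : ℕ} {f : Euc d → ℝ} (hf : Continuous f) :
    IntegrableOn f (QCube d) := by
  obtain ⟨K, hK, hQ⟩ := exists_isCompact_qCube_subset d
  exact (hf.continuousOn.integrableOn_compact hK).mono_set hQ

lemma setIntegral_qCube {d : ℕ} (f : Euc d → ℝ) :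
    ∫ x in QCube d, f x = ∫ y in Icc (0 : Fin d → ℝ) 1, f (WithLp.toLp 2 y) := by
  rw [← (PiLp.volume_preserving_toLp (Fin d)).setIntegral_preimage_emb
    (MeasurableEquiv.toLp 2 (Fin d → ℝ)).measurableEmbedding f (QCube d)]
  refine setIntegral_congr_set ?_
  have h : WithLp.toLp 2 ⁻¹' QCube d =
      Set.pi univ fun i => Ico ((0 : Fin d → ℝ) i) ((1 : Fin d → ℝ) i) := by
    ext y
    simp [QCube]
  rw [h]
  exact Measure.univ_pi_Ico_ae_eq_Icc

/-- The divergence of a periodic `C¹` vector field integrates to zero over the unit cell. -/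
lemma setIntegral_qCube_divergence_eq_zero {d : ℕ} (hd : d ≠ 0) (w : Fin d → Euc d → ℝ)
    (hw : ∀ k, ContDiff ℝ 1 (w k)) (hper : ∀ k, ZPeriodic (w k)) :
    ∫ x in QCube d, ∑ k, pd d k (w k) x = 0 := by
  obtain ⟨n, rfl⟩ := Nat.exists_eq_succ_of_ne_zero hd
  rw [setIntegral_qCube]
  let L : (Fin (n + 1) → ℝ) →L[ℝ] Euc (n + 1) :=
    (PiLp.continuousLinearEquiv 2 ℝ (fun _ : Fin (n + 1) => ℝ)).symm
  have hpd : ∀ k, Continuous (pd (n + 1) k (w k)) := fun k =>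
    ((hw k).continuous_fderiv one_ne_zero).clm_apply continuous_const
  have key := integral_divergence_of_hasFDerivAt_off_countable' (0 : Fin (n + 1) → ℝ) 1
    zero_le_one (fun k y => w k (WithLp.toLp 2 y))
    (fun k y => (fderiv ℝ (w k) (WithLp.toLp 2 y)).comp L) ∅ countable_empty
    (fun k => ((hw k).continuous.comp (PiLp.continuous_toLp 2 _)).continuousOn)
    (fun y _ k => (((hw k).differentiable one_ne_zero _).hasFDerivAt).comp y
      (PiLp.hasFDerivAt_toLp 2 y))
    ((continuous_finsetSum _ fun k _ =>
      (hpd k).comp (PiLp.continuous_toLp 2 _)).continuousOn.integrableOn_compact isCompact_Icc)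
  refine key.trans (Finset.sum_eq_zero fun k _ => sub_eq_zero.2 ?_)
  refine integral_congr_ae (Eventually.of_forall fun y => ?_)
  have h := hper k (WithLp.toLp 2 (k.insertNth 0 y)) (Pi.single k 1)
  have h2 : WithLp.toLp 2 (k.insertNth 0 y) + intVec (Pi.single k 1) =
      (WithLp.toLp 2 (k.insertNth 1 y) : Euc (n + 1)) := by
    ext j
    refine Fin.succAboveCases k ?_ (fun j => ?_) j <;> simp [intVec]
  rw [h2] at h
  exact h

lemma contDiff_pd {d : ℕ} {f : Euc d → ℝ} (hf : ContDiff ℝ 2 f) (k : Fin d) :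
    ContDiff ℝ 1 (fun x => pd d k f x) :=
  (hf.fderiv_right (m := 1) (by norm_num)).clm_apply contDiff_const

lemma ZPeriodic.pd {d : ℕ} {f : Euc d → ℝ} (hf : ZPeriodic f) (k : Fin d) :
    ZPeriodic (fun x => pd d k f x) := by
  intro x v
  have h : (fun y => f (y + intVec v)) = f := funext fun y => hf y v
  simp only [_root_.pd]
  rw [← fderiv_comp_add_right, h]

lemma norm_gradient_sq {d : ℕ} (f : Euc d → ℝ) (x : Euc d) :
    ‖gradient f x‖ ^ 2 = ∑ k, pd d k f x ^ 2 := by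
  rw [EuclideanSpace.norm_sq_eq]
  refine Finset.sum_congr rfl fun k _ => ?_
  rw [pd, ← inner_gradient_left, EuclideanSpace.inner_single_right]
  simp

lemma continuous_norm_gradient_sq {d : ℕ} {f : Euc d → ℝ} (hf : ContDiff ℝ 2 f) :
    Continuous fun x => ‖gradient f x‖ ^ 2 := by
  simp only [norm_gradient_sq]
  exact continuous_finsetSum _ fun k _ => (contDiff_pd hf k).continuous.pow 2

lemma continuous_lap {d : ℕ} {f : Euc d → ℝ} (hf : ContDiff ℝ 2 f) : Continuous (lap d f) :=
  continuous_finsetSum _ fun k _ =>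
    ((contDiff_pd hf k).continuous_fderiv one_ne_zero).clm_apply continuous_const

/-- Polarized integration by parts for the Dirichlet energies of two periodic functions. -/
lemma setIntegral_norm_gradient_sq_sub {d : ℕ} (hd : d ≠ 0) {f g : Euc d → ℝ}
    (hf : ContDiff ℝ 2 f) (hg : ContDiff ℝ 2 g) (hfp : ZPeriodic f) (hgp : ZPeriodic g) :
    ∫ x in QCube d, (‖gradient f x‖ ^ 2 - ‖gradient g x‖ ^ 2) =
      -∫ x in QCube d, (f x - g x) * (lap d f x + lap d g x) := by
  have h := setIntegral_qCube_divergence_eq_zero hd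
    (fun k x => (f x - g x) * (pd d k f x + pd d k g x))
    (fun k => ((hf.of_le one_le_two).sub (hg.of_le one_le_two)).mul
      ((contDiff_pd hf k).add (contDiff_pd hg k)))
    (fun k x v => by
      simp only [hfp x v, hgp x v, hfp.pd k x v, hgp.pd k x v])
  have hpt : ∀ x, ∑ k, pd d k (fun x => (f x - g x) * (pd d k f x + pd d k g x)) x =
      (‖gradient f x‖ ^ 2 - ‖gradient g x‖ ^ 2) + (f x - g x) * (lap d f x + lap d g x) := by
    intro x
    simp only [norm_gradient_sq, lap, ← Finset.sum_sub_distrib, ← Finset.sum_add_distrib,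
      Finset.mul_sum]
    refine Finset.sum_congr rfl fun k _ => ?_
    have h1 := (hf.differentiable two_ne_zero x).hasFDerivAt
    have h2 := (hg.differentiable two_ne_zero x).hasFDerivAt
    have h3 := ((contDiff_pd hf k).differentiable one_ne_zero x).hasFDerivAt
    have h4 := ((contDiff_pd hg k).differentiable one_ne_zero x).hasFDerivAt
    have h5 := ((h1.sub h2).mul (h3.add h4)).fderiv
    have h6 := congrArg (fun A => A (EuclideanSpace.single k 1)) h5
    simp only [_root_.add_apply, _root_.smul_apply,
      _root_.sub_apply, smul_eq_mul, Pi.sub_apply, Pi.add_apply] at h6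
    refine h6.trans ?_
    simp only [pd]
    ring
  have h1 : IntegrableOn (fun x => ‖gradient f x‖ ^ 2 - ‖gradient g x‖ ^ 2) (QCube d) :=
    integrableOn_qCube ((continuous_norm_gradient_sq hf).sub (continuous_norm_gradient_sq hg))
  have h2 : IntegrableOn (fun x => (f x - g x) * (lap d f x + lap d g x)) (QCube d) :=
    integrableOn_qCube ((hf.continuous.sub hg.continuous).mul
      ((continuous_lap hf).add (continuous_lap hg)))
  simp only [hpt] at h
  rw [integral_add h1 h2] at h
  linarith

/-- A jointly continuous function is bounded uniformly over compact sets of times and points. -/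
lemma exists_forall_norm_le_of_isCompact {X : Type*} [TopologicalSpace X] {K : Set X}
    (hK : IsCompact K) {J : Set ℝ} (hJ : IsCompact J) {I : Set ℝ} (hJI : J ⊆ I)
    {f : ℝ → X → ℝ} (hf : ContinuousOn (fun p : ℝ × X => f p.1 p.2) (I ×ˢ univ)) :
    ∃ C, ∀ τ ∈ J, ∀ x ∈ K, ‖f τ x‖ ≤ C := by
  obtain ⟨C, hC⟩ := (hJ.prod hK).exists_bound_of_continuousOn
    (hf.mono (prod_mono hJI (subset_univ K)))
  exact ⟨C, fun τ hτ x hx => hC (τ, x) ⟨hτ, hx⟩⟩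

lemma ContinuousOn.continuous_of_uncurry {X : Type*} [TopologicalSpace X] {I : Set ℝ}
    {f : ℝ → X → ℝ} (hf : ContinuousOn (fun p : ℝ × X => f p.1 p.2) (I ×ˢ univ))
    {t : ℝ} (ht : t ∈ I) : Continuous (f t) :=
  continuousOn_univ.1 <| hf.comp (f := fun x => (t, x)) (by fun_prop) fun _ _ => ⟨ht, trivial⟩

lemma ContinuousOn.continuousOn_of_uncurry {X : Type*} [TopologicalSpace X] {I : Set ℝ}
    {f : ℝ → X → ℝ} (hf : ContinuousOn (fun p : ℝ × X => f p.1 p.2) (I ×ˢ univ))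
    (x : X) : ContinuousOn (fun τ => f τ x) I :=
  hf.comp (f := fun τ => (τ, x)) (by fun_prop) fun _ hτ => ⟨hτ, trivial⟩

section ParametricIntegral

variable {X : Type*} [TopologicalSpace X] [MeasurableSpace X] [OpensMeasurableSpace X]
  {μ : Measure X} [IsFiniteMeasure μ] {K : Set X}

lemma continuousOn_integral_mul_of_isCompact (hK : IsCompact K) (hμ : ∀ᵐ x ∂μ, x ∈ K)
    {m : X → ℝ} (hm : Measurable m) (hm1 : ∀ x, ‖m x‖ ≤ 1) {I J : Set ℝ}
    (hJ : IsCompact J) (hJI : J ⊆ I) {f : ℝ → X → ℝ}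
    (hf : ContinuousOn (fun p : ℝ × X => f p.1 p.2) (I ×ˢ univ)) :
    ContinuousOn (fun τ => ∫ x, m x * f τ x ∂μ) J := by
  obtain ⟨C, hC⟩ := exists_forall_norm_le_of_isCompact hK hJ hJI hf
  refine continuousOn_of_dominated (bound := fun _ => C) (fun τ hτ => ?_) (fun τ hτ => ?_)
    (integrable_const C) (Eventually.of_forall fun x => ?_)
  · exact (hm.mul (hf.continuous_of_uncurry (hJI hτ)).measurable).aestronglyMeasurable
  · filter_upwards [hμ] with x hx
    rw [norm_mul]
    exact (mul_le_of_le_one_left (norm_nonneg _) (hm1 x)).trans (hC τ hτ x hx)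
  · exact continuousOn_const.mul ((hf.continuousOn_of_uncurry x).mono hJI)

/-- Product rule under the integral sign at a zero of the first factor: only that factor needs
to be differentiable in time. -/
lemma hasDerivAt_integral_sub_mul (hK : IsCompact K) (hμ : ∀ᵐ x ∂μ, x ∈ K)
    {m : X → ℝ} (hm : Measurable m) (hm1 : ∀ x, ‖m x‖ ≤ 1) {I : Set ℝ} {t : ℝ} (ht : I ∈ nhds t)
    {u u' v : ℝ → X → ℝ} (hu : ∀ τ ∈ I, ∀ x, HasDerivAt (fun s => u s x) (u' τ x) τ)
    (huc : ContinuousOn (fun p : ℝ × X => u p.1 p.2) (I ×ˢ univ))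
    (hu' : ContinuousOn (fun p : ℝ × X => u' p.1 p.2) (I ×ˢ univ))
    (hv : ContinuousOn (fun p : ℝ × X => v p.1 p.2) (I ×ˢ univ)) :
    HasDerivAt (fun τ => ∫ x, m x * ((u τ x - u t x) * v τ x) ∂μ)
      (∫ x, m x * (u' t x * v t x) ∂μ) t := by
  obtain ⟨δ, hδ, hδI⟩ := Metric.nhds_basis_closedBall.mem_iff.1 ht
  have htI : t ∈ I := mem_of_mem_nhds ht
  set J := Metric.closedBall t δ
  have hJ : IsCompact J := isCompact_closedBall t δ
  have hJt : J ∈ nhds t := Metric.closedBall_mem_nhds t hδ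
  obtain ⟨A, hA⟩ := exists_forall_norm_le_of_isCompact hK hJ hδI hu'
  obtain ⟨B, hB⟩ := exists_forall_norm_le_of_isCompact hK hJ hδI hv
  rw [hasDerivAt_iff_tendsto_slope]
  have hslope : slope (fun τ => ∫ x, m x * ((u τ x - u t x) * v τ x) ∂μ) t =
      fun τ => ∫ x, m x * (slope (fun s => u s x) t τ * v τ x) ∂μ := by
    funext τ
    simp only [slope_def_field, sub_self, zero_mul, mul_zero, integral_zero, sub_zero]
    rw [← integral_div]
    congr 1
    funext x
    ring
  rw [hslope]
  have hev : ∀ᶠ τ in nhdsWithin t {t}ᶜ, τ ∈ J ∧ τ ≠ t :=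
    (eventually_nhdsWithin_of_eventually_nhds hJt).and self_mem_nhdsWithin
  refine tendsto_integral_filter_of_dominated_convergence (fun _ => A * B) ?_ ?_
    (integrable_const _) (Eventually.of_forall fun x => ?_)
  · filter_upwards [hev] with τ hτ
    simp only [slope_def_field]
    have h1 := (huc.continuous_of_uncurry (hδI hτ.1)).measurable
    have h2 := (huc.continuous_of_uncurry htI).measurable
    have h3 := (hv.continuous_of_uncurry (hδI hτ.1)).measurable
    exact (hm.mul (((h1.sub h2).div_const _).mul h3)).aestronglyMeasurable
  · filter_upwards [hev] with τ hτ
    filter_upwards [hμ] with x hx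
    have h1 : ‖u τ x - u t x‖ ≤ A * ‖τ - t‖ :=
      (convex_closedBall t δ).norm_image_sub_le_of_norm_hasDerivWithin_le
        (fun s hs => (hu s (hδI hs) x).hasDerivWithinAt) (fun s hs => hA s hs x hx)
        (Metric.mem_closedBall_self hδ.le) hτ.1
    have h2 : ‖slope (fun s => u s x) t τ‖ ≤ A := by
      rw [slope_def_field, norm_div]
      exact (div_le_iff₀ (norm_pos_iff.2 (sub_ne_zero.2 hτ.2))).2 h1
    rw [norm_mul, norm_mul]
    refine (mul_le_of_le_one_left (by positivity) (hm1 x)).trans ?_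
    exact mul_le_mul h2 (hB τ hτ.1 x hx) (norm_nonneg _) ((norm_nonneg _).trans h2)
  · refine tendsto_const_nhds.mul ((hasDerivAt_iff_tendsto_slope.1 (hu t htI x)).mul ?_)
    exact ((hv.continuousOn_of_uncurry x).continuousAt ht).tendsto.mono_left nhdsWithin_le_nhds

/-- Differentiation of a weighted integral under the integral sign. -/
lemma hasDerivAt_integral_mul_of_isCompact (hK : IsCompact K) (hμ : ∀ᵐ x ∂μ, x ∈ K)
    {m : X → ℝ} (hm : Measurable m) (hm1 : ∀ x, ‖m x‖ ≤ 1) {I : Set ℝ} {t : ℝ} (ht : I ∈ nhds t)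
    {u u' : ℝ → X → ℝ} (hu : ∀ τ ∈ I, ∀ x, HasDerivAt (fun s => u s x) (u' τ x) τ)
    (huc : ContinuousOn (fun p : ℝ × X => u p.1 p.2) (I ×ˢ univ))
    (hu' : ContinuousOn (fun p : ℝ × X => u' p.1 p.2) (I ×ˢ univ)) :
    HasDerivAt (fun τ => ∫ x, m x * u τ x ∂μ) (∫ x, m x * u' t x ∂μ) t := by
  have hint : ∀ τ ∈ I, Integrable (fun x => m x * u τ x) μ := by
    intro τ hτ
    have hc := huc.continuous_of_uncurry hτ
    obtain ⟨C, hC⟩ := hK.exists_bound_of_continuousOn hc.continuousOn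
    refine Integrable.of_bound (hm.mul hc.measurable).aestronglyMeasurable C ?_
    filter_upwards [hμ] with x hx
    rw [norm_mul]
    exact (mul_le_of_le_one_left (norm_nonneg _) (hm1 x)).trans (hC x hx)
  have h := (hasDerivAt_integral_sub_mul hK hμ hm hm1 ht hu huc hu'
    (v := fun _ _ => 1) continuousOn_const).add_const (∫ x, m x * u t x ∂μ)
  simp only [mul_one] at h
  refine h.congr_of_eventuallyEq ?_
  filter_upwards [ht] with τ hτ
  simp only [mul_sub]
  rw [integral_sub (hint τ hτ) (hint t (mem_of_mem_nhds ht)), sub_add_cancel]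

end ParametricIntegral

lemma W_nonneg (s : ℝ) : 0 ≤ W s := by
  unfold W
  positivity

lemma continuous_W : Continuous W := by
  unfold W
  fun_prop

lemma continuous_W' : Continuous W' := by
  unfold W'
  fun_prop

lemma hasDerivAt_W (s : ℝ) : HasDerivAt W (W' s) s := by
  have h := (((hasDerivAt_id s).pow 2).mul (((hasDerivAt_id s).const_sub 1).pow 2)).div_const 2
  refine h.congr_deriv ?_
  simp [W']
  ring

lemma continuous_sqrt_two_mul_W : Continuous fun s => Real.sqrt (2 * W s) :=
  (continuous_const.mul continuous_W).sqrt

lemma sigma0_pos : 0 < sigma0 := by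
  refine intervalIntegral.intervalIntegral_pos_of_pos_on
    (continuous_sqrt_two_mul_W.intervalIntegrable _ _) (fun a ha => ?_) one_pos
  have h0 : 0 < a := ha.1
  have h1 : 0 < 1 - a := sub_pos.2 ha.2
  unfold W
  positivity

lemma hasDerivAt_Gfun (s : ℝ) :
    HasDerivAt Gfun (sigma0⁻¹ * Real.sqrt (2 * W s)) s :=
  (intervalIntegral.integral_hasDerivAt_right
    (continuous_sqrt_two_mul_W.intervalIntegrable _ _)
    continuous_sqrt_two_mul_W.stronglyMeasurable.stronglyMeasurableAtFilter
    continuous_sqrt_two_mul_W.continuousAt).const_mul _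

lemma continuous_Gfun : Continuous Gfun :=
  continuous_iff_continuousAt.2 fun s => (hasDerivAt_Gfun s).continuousAt

namespace IsACSolution

variable {d N : ℕ} {T ε : ℝ} {u : Fin N → ℝ → Euc d → ℝ}

lemma hasDerivAt_time (hu : IsACSolution d N T ε u) (i : Fin N) {t : ℝ} (ht : t ∈ Ioo 0 T)
    (x : Euc d) : HasDerivAt (fun s => u i s x) (deriv (fun s => u i s x) t) t :=
  (((hu.regt i x).contDiffAt (Ico_mem_nhds ht.1 ht.2)).differentiableAt
    one_ne_zero).hasDerivAt

lemma cont_u_Ioo (hu : IsACSolution d N T ε u) (i : Fin N) :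
    ContinuousOn (fun p : ℝ × Euc d => u i p.1 p.2) (Ioo 0 T ×ˢ univ) :=
  (hu.cont_u i).mono (prod_mono Ioo_subset_Ico_self subset_rfl)

lemma cont_lap_Ioo (hu : IsACSolution d N T ε u) (i : Fin N) :
    ContinuousOn (fun p : ℝ × Euc d => lap d (u i p.1) p.2) (Ioo 0 T ×ˢ univ) :=
  (hu.cont_lap i).mono (prod_mono Ioo_subset_Ico_self subset_rfl)

lemma continuous_deriv_time (hu : IsACSolution d N T ε u) (i : Fin N) {t : ℝ}
    (ht : t ∈ Ioo 0 T) : Continuous fun x => deriv (fun s => u i s x) t :=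
  ContinuousOn.continuous_of_uncurry (f := fun t x => deriv (fun s => u i s x) t)
    (hu.cont_dt i) ht

lemma continuousOn_comp_deriv (hu : IsACSolution d N T ε u) (i : Fin N) {φ : ℝ → ℝ}
    (hφ : Continuous φ) :
    ContinuousOn (fun p : ℝ × Euc d => φ (u i p.1 p.2) * deriv (fun s => u i s p.2) p.1)
      (Ioo 0 T ×ˢ univ) :=
  (hφ.comp_continuousOn (hu.cont_u_Ioo i)).mul (hu.cont_dt i)

lemma hasDerivAt_setIntegral_comp (hu : IsACSolution d N T ε u) (i : Fin N) {t : ℝ}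
    (ht : t ∈ Ioo 0 T) {m : Euc d → ℝ} (hm : Measurable m) (hm1 : ∀ x, ‖m x‖ ≤ 1)
    {φ φ' : ℝ → ℝ} (hφ : ∀ s, HasDerivAt φ (φ' s) s) (hφ' : Continuous φ') :
    HasDerivAt (fun τ => ∫ x in QCube d, m x * φ (u i τ x))
      (∫ x in QCube d, m x * (φ' (u i t x) * deriv (fun s => u i s x) t)) t := by
  obtain ⟨K, hK, hQ⟩ := exists_isCompact_qCube_subset d
  refine hasDerivAt_integral_mul_of_isCompact hK
    ((ae_restrict_mem (measurableSet_qCube d)).mono fun x hx => hQ hx) hm hm1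
    (isOpen_Ioo.mem_nhds ht) (u := fun τ x => φ (u i τ x))
    (u' := fun τ x => φ' (u i τ x) * deriv (fun s => u i s x) τ)
    (fun τ hτ x => (hφ _).comp τ (hu.hasDerivAt_time i hτ x)) ?_
    (hu.continuousOn_comp_deriv i hφ')
  have hc : Continuous φ := continuous_iff_continuousAt.2 fun s => (hφ s).continuousAt
  exact hc.comp_continuousOn (hu.cont_u_Ioo i)

lemma hasDerivAt_muI (hd : d ≠ 0) (hu : IsACSolution d N T ε u) (i : Fin N) {t : ℝ}
    (ht : t ∈ Ioo 0 T) :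
    HasDerivAt (muI d ε (u i))
      (sigma0⁻¹ * ∫ x in QCube d, (-(ε * lap d (u i t) x) + W' (u i t x) / ε) *
        deriv (fun s => u i s x) t) t := by
  obtain ⟨K, hK, hQ⟩ := exists_isCompact_qCube_subset d
  have hμ : ∀ᵐ x ∂(volume : Measure (Euc d)).restrict (QCube d), x ∈ K :=
    (ae_restrict_mem (measurableSet_qCube d)).mono fun x hx => hQ hx
  have hI : Ioo 0 T ∈ nhds t := isOpen_Ioo.mem_nhds ht
  have hlap : ContinuousOn (fun p : ℝ × Euc d => lap d (u i p.1) p.2 + lap d (u i t) p.2)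
      (Ioo 0 T ×ˢ univ) :=
    (hu.cont_lap_Ioo i).add ((continuous_lap (hu.regx i t)).comp continuous_snd).continuousOn
  have h1 := hasDerivAt_integral_sub_mul hK hμ (m := fun _ => 1) measurable_const (by simp) hI
    (u := u i) (u' := fun τ x => deriv (fun s => u i s x) τ)
    (v := fun τ x => lap d (u i τ) x + lap d (u i t) x)
    (fun τ hτ x => hu.hasDerivAt_time i hτ x) (hu.cont_u_Ioo i) (hu.cont_dt i) hlap
  have h2 := hu.hasDerivAt_setIntegral_comp i ht (m := fun _ => 1) measurable_const (by simp)
    hasDerivAt_W continuous_W'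
  simp only [one_mul] at h1 h2
  have hW : ∀ τ, IntegrableOn (fun x => W (u i τ x)) (QCube d) := fun τ =>
    integrableOn_qCube (continuous_W.comp (hu.regx i τ).continuous)
  have hgrad : ∀ τ, IntegrableOn (fun x => ‖gradient (u i τ) x‖ ^ 2) (QCube d) := fun τ =>
    integrableOn_qCube (continuous_norm_gradient_sq (hu.regx i τ))
  have hmu : ∀ τ, muI d ε (u i) τ = sigma0⁻¹ * (ε / 2 * (∫ x in QCube d,
      ‖gradient (u i τ) x‖ ^ 2) + ε⁻¹ * ∫ x in QCube d, W (u i τ x)) := by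
    intro τ
    rw [muI, ← integral_const_mul (ε / 2), ← integral_const_mul ε⁻¹,
      ← integral_add ((hgrad τ).const_mul _) ((hW τ).const_mul _)]
    congr 2
    funext x
    ring
  have hdiff : muI d ε (u i) = fun τ => sigma0⁻¹ * (ε / 2 * ((∫ x in QCube d,
      ‖gradient (u i t) x‖ ^ 2) - ∫ x in QCube d, (u i τ x - u i t x) *
        (lap d (u i τ) x + lap d (u i t) x)) + ε⁻¹ * ∫ x in QCube d, W (u i τ x)) := by
    funext τ
    have h := setIntegral_norm_gradient_sq_sub hd (hu.regx i τ) (hu.regx i t)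
      (hu.periodic i τ) (hu.periodic i t)
    rw [integral_sub (hgrad τ) (hgrad t)] at h
    rw [hmu, ← sub_eq_iff_eq_add'.2 (sub_eq_iff_eq_add.1 h)]
    ring
  rw [hdiff]
  refine ((((h1.const_sub _).const_mul (ε / 2)).add (h2.const_mul ε⁻¹)).const_mul
    sigma0⁻¹).congr_deriv ?_
  have hdt := hu.continuous_deriv_time i ht
  have hi1 : IntegrableOn (fun x => deriv (fun s => u i s x) t *
      (lap d (u i t) x + lap d (u i t) x)) (QCube d) :=
    integrableOn_qCube (hdt.mul ((continuous_lap (hu.regx i t)).add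
      (continuous_lap (hu.regx i t))))
  have hi2 : IntegrableOn (fun x => W' (u i t x) * deriv (fun s => u i s x) t) (QCube d) :=
    integrableOn_qCube ((continuous_W'.comp (hu.regx i t).continuous).mul hdt)
  rw [← mul_neg_one, mul_comm _ (-1 : ℝ), ← integral_const_mul (-1), ← integral_const_mul (ε / 2),
    ← integral_const_mul ε⁻¹, ← integral_add ((hi1.const_mul _).const_mul _) (hi2.const_mul _)]
  congr 2
  funext x
  ring

lemma sum_mul_deriv_eq_zero (hu : IsACSolution d N T ε u)
    (hsph : ∀ x, ∀ t ∈ Ico 0 T, ∑ i, (u i t x) ^ 2 = 1) {t : ℝ} (ht : t ∈ Ioo 0 T)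
    (x : Euc d) : ∑ i, u i t x * deriv (fun s => u i s x) t = 0 := by
  have h : HasDerivAt (fun τ => ∑ i, (u i τ x) ^ 2)
      (∑ i, 2 * (u i t x * deriv (fun s => u i s x) t)) t := by
    refine (HasDerivAt.fun_sum fun i _ => (hu.hasDerivAt_time i ht x).pow 2).congr_deriv ?_
    refine Finset.sum_congr rfl fun i _ => ?_
    norm_num
    ring
  have h1 : HasDerivAt (fun τ => ∑ i, (u i τ x) ^ 2) 0 t :=
    (hasDerivAt_const t (1 : ℝ)).congr_of_eventuallyEq <| by
      filter_upwards [Ico_mem_nhds ht.1 ht.2] with τ hτ using hsph x τ hτ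
  have h2 := h.unique h1
  rw [← Finset.mul_sum] at h2
  linarith

lemma sum_energy_deriv_eq (hu : IsACSolution d N T ε u)
    (hsph : ∀ x, ∀ t ∈ Ico 0 T, ∑ i, (u i t x) ^ 2 = 1) {t : ℝ} (ht : t ∈ Ioo 0 T)
    (x : Euc d) :
    ∑ i, (-(ε * lap d (u i t) x) + W' (u i t x) / ε) * deriv (fun s => u i s x) t =
      -∑ i, ε * deriv (fun s => u i s x) t ^ 2 := by
  have h0 := hu.sum_mul_deriv_eq_zero hsph ht x
  set l := ∑ j, u j t x * (-(ε * lap d (u j t) x) + W' (u j t x) / ε) with hl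
  have h : ∀ i, (-(ε * lap d (u i t) x) + W' (u i t x) / ε) * deriv (fun s => u i s x) t =
      l * (u i t x * deriv (fun s => u i s x) t) - ε * deriv (fun s => u i s x) t ^ 2 := by
    intro i
    have he := hu.eqn i x t ht
    rw [← hl] at he
    linear_combination (deriv (fun s => u i s x) t) * he
  rw [Finset.sum_congr rfl fun i _ => h i, Finset.sum_sub_distrib, ← Finset.mul_sum, h0]
  ring

/-- The energy dissipation identity. -/
lemma hasDerivAt_muE (hd : d ≠ 0) (hu : IsACSolution d N T ε u)
    (hsph : ∀ x, ∀ t ∈ Ico 0 T, ∑ i, (u i t x) ^ 2 = 1) {t : ℝ} (ht : t ∈ Ioo 0 T) :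
    HasDerivAt (muE d N ε u)
      (-(sigma0⁻¹ * ∑ i, ∫ x in QCube d, ε * deriv (fun s => u i s x) t ^ 2)) t := by
  have h : HasDerivAt (muE d N ε u) _ t :=
    HasDerivAt.fun_sum fun i _ => hu.hasDerivAt_muI hd i ht
  refine h.congr_deriv ?_
  have hdt := fun i => hu.continuous_deriv_time i ht
  rw [← Finset.mul_sum, ← mul_neg]
  congr 1
  have hi1 : ∀ i, IntegrableOn (fun x => ε * deriv (fun s => u i s x) t ^ 2) (QCube d) :=
    fun i => integrableOn_qCube (continuous_const.mul ((hdt i).pow 2))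
  have hi2 : ∀ i, IntegrableOn (fun x => (-(ε * lap d (u i t) x) + W' (u i t x) / ε) *
      deriv (fun s => u i s x) t) (QCube d) := fun i =>
    integrableOn_qCube (((continuous_const.mul (continuous_lap (hu.regx i t))).neg.add
      ((continuous_W'.comp (hu.regx i t).continuous).div_const ε)).mul (hdt i))
  rw [← integral_finsetSum _ fun i _ => hi1 i, ← integral_neg,
    ← integral_finsetSum _ fun i _ => hi2 i]
  congr 1
  funext x
  exact hu.sum_energy_deriv_eq hsph ht x

lemma continuousOn_muE (hu : IsACSolution d N T ε u) {J : Set ℝ} (hJ : IsCompact J)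
    (hJT : J ⊆ Ico 0 T) : ContinuousOn (muE d N ε u) J := by
  obtain ⟨K, hK, hQ⟩ := exists_isCompact_qCube_subset d
  refine continuousOn_finsetSum _ fun i _ => continuousOn_const.mul ?_
  have h := continuousOn_integral_mul_of_isCompact (μ := volume.restrict (QCube d)) hK
    ((ae_restrict_mem (measurableSet_qCube d)).mono fun x hx => hQ hx)
    (m := fun _ => 1) measurable_const (by simp) hJ hJT
    (f := fun τ x => ε * ‖gradient (u i τ) x‖ ^ 2 / 2 + W (u i τ x) / ε)
    (((continuousOn_const.mul ((hu.cont_grad i).norm.pow 2)).div_const 2).add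
      ((continuous_W.comp_continuousOn (hu.cont_u i)).div_const ε))
  simpa only [one_mul] using h

lemma muE_le_muE_zero (hd : d ≠ 0) (hε : 0 < ε) (hu : IsACSolution d N T ε u)
    (hsph : ∀ x, ∀ t ∈ Ico 0 T, ∑ i, (u i t x) ^ 2 = 1) {t : ℝ} (ht : t ∈ Ico 0 T) :
    muE d N ε u t ≤ muE d N ε u 0 := by
  have hsub : Icc 0 t ⊆ Ico 0 T := fun τ hτ => ⟨hτ.1, hτ.2.trans_lt ht.2⟩
  have hder : ∀ τ ∈ interior (Icc 0 t), HasDerivAt (muE d N ε u)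
      (-(sigma0⁻¹ * ∑ i, ∫ x in QCube d, ε * deriv (fun s => u i s x) τ ^ 2)) τ := by
    intro τ hτ
    rw [interior_Icc] at hτ
    exact hu.hasDerivAt_muE hd hsph ⟨hτ.1, hτ.2.trans ht.2⟩
  refine antitoneOn_of_deriv_nonpos (convex_Icc 0 t) (hu.continuousOn_muE isCompact_Icc hsub)
    (fun τ hτ => (hder τ hτ).differentiableAt.differentiableWithinAt) (fun τ hτ => ?_)
    (left_mem_Icc.2 ht.1) (right_mem_Icc.2 ht.1) ht.1
  rw [(hder τ hτ).deriv, neg_nonpos]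
  exact mul_nonneg (inv_nonneg.2 sigma0_pos.le) (Finset.sum_nonneg fun i _ =>
    integral_nonneg fun x => by positivity)

lemma setIntegral_W_div_le_muE (hε : 0 < ε) (hu : IsACSolution d N T ε u) (i : Fin N) (t : ℝ) :
    sigma0⁻¹ * ∫ x in QCube d, W (u i t x) / ε ≤ muE d N ε u t := by
  have hσ : 0 ≤ sigma0⁻¹ := inv_nonneg.2 sigma0_pos.le
  have hnn : ∀ j, 0 ≤ muI d ε (u j) t := fun j =>
    mul_nonneg hσ <| integral_nonneg fun x => by
      have := W_nonneg (u j t x)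
      positivity
  refine le_trans ?_ (Finset.single_le_sum (f := fun j => muI d ε (u j) t)
    (fun j _ => hnn j) (Finset.mem_univ i))
  have hW := (continuous_W.comp (hu.regx i t).continuous).div_const ε
  refine mul_le_mul_of_nonneg_left (setIntegral_mono (integrableOn_qCube hW)
    (integrableOn_qCube (((continuous_const.mul (continuous_norm_gradient_sq
      (hu.regx i t))).div_const 2).add hW)) fun x => ?_) hσ
  exact le_add_of_nonneg_left (by positivity)

/-- Young's inequality, with weight `h`, for the time derivative of a weighted integral of
`G ∘ uᵢ`. -/
lemma setIntegral_mul_deriv_Gfun_le (hε : 0 < ε) (hu : IsACSolution d N T ε u) (i : Fin N)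
    {t : ℝ} (ht : t ∈ Ioo 0 T) {m : Euc d → ℝ} (hm : Measurable m) (hm1 : ∀ x, ‖m x‖ ≤ 1)
    {h : ℝ} (hh : 0 < h) :
    ∫ x in QCube d, m x * (sigma0⁻¹ * Real.sqrt (2 * W (u i t x)) *
        deriv (fun s => u i s x) t) ≤
      h / 2 * (sigma0⁻¹ * ∑ j, ∫ x in QCube d, ε * deriv (fun s => u j s x) t ^ 2) +
        muE d N ε u t / h := by
  have hσ : 0 < sigma0⁻¹ := inv_pos.2 sigma0_pos
  have hdt := hu.continuous_deriv_time i ht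
  have hcont := (hu.regx i t).continuous
  have hi1 : IntegrableOn (fun x => ε * deriv (fun s => u i s x) t ^ 2) (QCube d) :=
    integrableOn_qCube (continuous_const.mul (hdt.pow 2))
  have hi2 : IntegrableOn (fun x => W (u i t x) / ε) (QCube d) :=
    integrableOn_qCube ((continuous_W.comp hcont).div_const ε)
  have hi3 : IntegrableOn (fun x => sigma0⁻¹ * Real.sqrt (2 * W (u i t x)) *
      deriv (fun s => u i s x) t) (QCube d) :=
    integrableOn_qCube ((continuous_const.mul
      (continuous_sqrt_two_mul_W.comp hcont)).mul hdt)
  have hpt : ∀ x, m x * (sigma0⁻¹ * Real.sqrt (2 * W (u i t x)) * deriv (fun s => u i s x) t) ≤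
      h / 2 * sigma0⁻¹ * (ε * deriv (fun s => u i s x) t ^ 2) +
        sigma0⁻¹ / h * (W (u i t x) / ε) := by
    intro x
    set p := deriv (fun s => u i s x) t
    set r := Real.sqrt (2 * W (u i t x))
    have hr : r ^ 2 = 2 * W (u i t x) := Real.sq_sqrt (by linarith [W_nonneg (u i t x)])
    have hr0 : 0 ≤ r := Real.sqrt_nonneg _
    have h1 : m x * (sigma0⁻¹ * r * p) ≤ sigma0⁻¹ * (r * |p|) := by
      refine (le_abs_self _).trans ?_
      rw [abs_mul, abs_mul, abs_of_nonneg (mul_nonneg hσ.le hr0), mul_assoc]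
      exact mul_le_of_le_one_left (by positivity) (hm1 x)
    have h2 : r * |p| ≤ h / 2 * (ε * p ^ 2) + W (u i t x) / ε / h := by
      have hW : W (u i t x) = r ^ 2 / 2 := by linarith
      rw [hW, ← sq_abs p, ← sub_nonneg]
      have : h / 2 * (ε * |p| ^ 2) + r ^ 2 / 2 / ε / h - r * |p| =
          (h * ε * |p| - r) ^ 2 / (2 * ε * h) := by
        field_simp
        ring
      rw [this]
      positivity
    calc m x * (sigma0⁻¹ * r * p) ≤ sigma0⁻¹ * (r * |p|) := h1
      _ ≤ sigma0⁻¹ * (h / 2 * (ε * p ^ 2) + W (u i t x) / ε / h) :=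
        mul_le_mul_of_nonneg_left h2 hσ.le
      _ = _ := by ring
  have hint : IntegrableOn (fun x => m x * (sigma0⁻¹ * Real.sqrt (2 * W (u i t x)) *
      deriv (fun s => u i s x) t)) (QCube d) :=
    hi3.bdd_mul hm.aestronglyMeasurable (Eventually.of_forall hm1)
  refine (setIntegral_mono hint ((hi1.const_mul _).add (hi2.const_mul _)) hpt).trans ?_
  simp only [Pi.add_apply]
  rw [integral_add (hi1.const_mul _) (hi2.const_mul _), integral_const_mul (h / 2 * sigma0⁻¹),
    integral_const_mul (sigma0⁻¹ / h), mul_assoc, div_mul_eq_mul_div sigma0⁻¹]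
  refine add_le_add
    (mul_le_mul_of_nonneg_left (mul_le_mul_of_nonneg_left ?_ hσ.le) (by positivity))
    (div_le_div_of_nonneg_right (hu.setIntegral_W_div_le_muE hε i t) hh.le)
  exact Finset.single_le_sum
    (f := fun j => ∫ x in QCube d, ε * deriv (fun s => u j s x) t ^ 2)
    (fun j _ => integral_nonneg fun x => by positivity) (Finset.mem_univ i)

end IsACSolution

/-- For a classical solution of (AC) with `Σᵢ uᵢ² ≡ 1` and
`μ₀ᵋ(Q) ≤ D`: for each `i` and all `0 ≤ t₁ < t₂ < T`,
`∫_Q |G(uᵢ(x,t₂)) - G(uᵢ(x,t₁))| dx ≤ (3/2) D √(t₂ - t₁)`. -/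
theorem holder_continuity_in_time
    {d N : ℕ} (hd : 2 ≤ d) (hN : 2 ≤ N) {T ε : ℝ} (hT : 0 < T) (hε : ε ∈ Ioo (0:ℝ) 1)
    {D : ℝ} (hD : 0 < D)
    (u : Fin N → ℝ → Euc d → ℝ) (hu : IsACSolution d N T ε u)
    (hsph : ∀ x, ∀ t ∈ Ico 0 T, ∑ i, (u i t x) ^ 2 = 1)
    (hinit : muE d N ε u 0 ≤ D) :
    ∀ i, ∀ t₁ t₂ : ℝ, 0 ≤ t₁ → t₁ < t₂ → t₂ < T →
      (∫ x in QCube d, |Gfun (u i t₂ x) - Gfun (u i t₁ x)|) ≤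
        (3 / 2) * D * Real.sqrt (t₂ - t₁) := by
  intro i t₁ t₂ h0 h12 h2T
  have hd0 : d ≠ 0 := by omega
  set h := Real.sqrt (t₂ - t₁) with hh_def
  have hh : 0 < h := Real.sqrt_pos.2 (sub_pos.2 h12)
  have hsq : h ^ 2 = t₂ - t₁ := Real.sq_sqrt (sub_pos.2 h12).le
  have hsub : Icc t₁ t₂ ⊆ Ico 0 T := fun τ hτ => ⟨h0.trans hτ.1, hτ.2.trans_lt h2T⟩
  have hmuE : ∀ t ∈ Ico 0 T, muE d N ε u t ≤ D := fun t ht =>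
    (hu.muE_le_muE_zero hd0 hε.1 hsph ht).trans hinit
  have hG : ∀ t, Continuous fun x => Gfun (u i t x) := fun t =>
    continuous_Gfun.comp (hu.regx i t).continuous
  obtain ⟨m, hm, hm1, hmabs⟩ : ∃ m : Euc d → ℝ, Measurable m ∧ (∀ x, ‖m x‖ ≤ 1) ∧
      ∀ x, |Gfun (u i t₂ x) - Gfun (u i t₁ x)| =
        m x * Gfun (u i t₂ x) - m x * Gfun (u i t₁ x) := by
    refine ⟨fun x => if Gfun (u i t₁ x) ≤ Gfun (u i t₂ x) then 1 else -1, ?_, ?_, ?_⟩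
    · exact Measurable.ite (measurableSet_le (hG t₁).measurable (hG t₂).measurable)
        measurable_const measurable_const
    · intro x
      dsimp only
      split_ifs <;> simp
    · intro x
      dsimp only
      split_ifs with hle
      · rw [abs_of_nonneg (sub_nonneg.2 hle)]
        ring
      · rw [abs_of_nonpos (sub_nonpos.2 (not_le.1 hle).le)]
        ring
  have hmG : ∀ t, IntegrableOn (fun x => m x * Gfun (u i t x)) (QCube d) := fun t =>
    (integrableOn_qCube (hG t)).bdd_mul hm.aestronglyMeasurable (Eventually.of_forall hm1)
  let Ψ : ℝ → ℝ := fun t =>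
    (∫ x in QCube d, m x * Gfun (u i t x)) + h / 2 * muE d N ε u t - D / h * t
  have hcont : ContinuousOn Ψ (Icc t₁ t₂) := by
    obtain ⟨K, hK, hQ⟩ := exists_isCompact_qCube_subset d
    have h1 := continuousOn_integral_mul_of_isCompact (μ := volume.restrict (QCube d)) hK
      ((ae_restrict_mem (measurableSet_qCube d)).mono fun x hx => hQ hx) hm hm1
      isCompact_Icc hsub (f := fun τ x => Gfun (u i τ x))
      (continuous_Gfun.comp_continuousOn (hu.cont_u i))
    exact (h1.add (continuousOn_const.mul (hu.continuousOn_muE isCompact_Icc hsub))).sub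
      (continuousOn_const.mul continuousOn_id)
  have hder : ∀ t ∈ interior (Icc t₁ t₂), ∃ c ≤ 0, HasDerivAt Ψ c t := by
    intro t ht
    rw [interior_Icc] at ht
    have ht' : t ∈ Ioo 0 T := ⟨h0.trans_lt ht.1, ht.2.trans h2T⟩
    refine ⟨_, ?_, ((hu.hasDerivAt_setIntegral_comp i ht' hm hm1 hasDerivAt_Gfun
      (continuous_const.mul continuous_sqrt_two_mul_W)).add
      ((hu.hasDerivAt_muE hd0 hsph ht').const_mul (h / 2))).sub
      ((hasDerivAt_id t).const_mul (D / h))⟩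
    have h1 := hu.setIntegral_mul_deriv_Gfun_le hε.1 i ht' hm hm1 hh
    have h2 := div_le_div_of_nonneg_right (hmuE t (Ioo_subset_Ico_self ht')) hh.le
    linarith
  have hanti : Ψ t₂ ≤ Ψ t₁ := by
    refine antitoneOn_of_deriv_nonpos (convex_Icc t₁ t₂) hcont (fun t ht => ?_) (fun t ht => ?_)
      (left_mem_Icc.2 h12.le) (right_mem_Icc.2 h12.le) h12.le
    · obtain ⟨c, -, hc⟩ := hder t ht
      exact hc.differentiableAt.differentiableWithinAt
    · obtain ⟨c, hc0, hc⟩ := hder t ht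
      exact hc.deriv.trans_le hc0
  have hE1 : h / 2 * muE d N ε u t₁ ≤ h / 2 * D :=
    mul_le_mul_of_nonneg_left (hmuE t₁ (hsub (left_mem_Icc.2 h12.le))) (by positivity)
  have hE2 : 0 ≤ h / 2 * muE d N ε u t₂ :=
    mul_nonneg (by positivity) <| le_trans
      (mul_nonneg (inv_nonneg.2 sigma0_pos.le) <| integral_nonneg fun x =>
        div_nonneg (W_nonneg _) hε.1.le) (hu.setIntegral_W_div_le_muE hε.1 i t₂)
  have hDh : D / h * t₂ - D / h * t₁ = D * h := by
    rw [← mul_sub, ← hsq]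
    field_simp
  simp only [hmabs]
  rw [integral_sub (hmG t₂) (hmG t₁)]
  simp only [Ψ] at hanti
  linarith
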